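/- arXiv:0707.1521 — 2 statements merged into one kernel-verified Lean document; each statement's English description precedes it below -/
import Mathlib

section
/- Let Ψ and Φ be unit vectors in H = ℂ^{d_A} ⊗ ℂ^{d_B} that are one-sided orthogonal on the B side, let α, β ∈ ℂ with |α|² + |β|² = 1, and set ρ^B = |α|² Tr_A|Ψ⟩⟨Ψ| + |β|² Tr_A|Φ⟩⟨Φ| and ρ^A = |α|² Tr_B|Ψ⟩⟨Ψ| + |β|² Tr_B|Φ⟩⟨Φ|. Then S(ρ^B) = |α|²E(Ψ) + |β|²E(Φ) + h₂(|α|²), and moreover S(ρ^B) ≥ S(ρ^A). -/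
open scoped BigOperators

noncomputable section

namespace EoS

/-- Vectors of `ℂ^{dA} ⊗ ℂ^{dB}`, modeled as `EuclideanSpace ℂ (Fin dA × Fin dB)`. -/
abbrev TensorSpace (dA dB : ℕ) := EuclideanSpace ℂ (Fin dA × Fin dB)

variable {dA dB : ℕ}

/-- The rank-one operator `|ψ⟩⟨ψ| = ψ ψ†`, as a matrix. -/
def ketbra (ψ : TensorSpace dA dB) : Matrix (Fin dA × Fin dB) (Fin dA × Fin dB) ℂ :=
  fun p q => ψ p * (starRingEnd ℂ) (ψ q)

/-- Partial trace over the `B` system. -/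
def trB (ρ : Matrix (Fin dA × Fin dB) (Fin dA × Fin dB) ℂ) : Matrix (Fin dA) (Fin dA) ℂ :=
  fun a a' => ∑ b : Fin dB, ρ (a, b) (a', b)

/-- Partial trace over the `A` system. -/
def trA (ρ : Matrix (Fin dA × Fin dB) (Fin dA × Fin dB) ℂ) : Matrix (Fin dB) (Fin dB) ℂ :=
  fun b b' => ∑ a : Fin dA, ρ (a, b) (a, b')

open scoped Classical in
/-- Von Neumann entropy (base-2), via eigenvalues; junk value `0` on non-Hermitian input. -/
def vnEntropy {n : Type*} [Fintype n] [DecidableEq n] (ρ : Matrix n n ℂ) : ℝ :=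
  if h : ρ.IsHermitian then -∑ i, (h.eigenvalues i) * Real.logb 2 (h.eigenvalues i) else 0

/-- Entropy of entanglement of a (unit) vector. -/
def ent (ψ : TensorSpace dA dB) : ℝ := vnEntropy (trB (ketbra ψ))

/-- Entropy of entanglement of a nonzero, not necessarily normalized, vector. -/
def entN (ψ : TensorSpace dA dB) : ℝ := ent ((‖ψ‖ : ℝ)⁻¹ • ψ)

/-- Binary entropy (base 2). -/
def h2 (x : ℝ) : ℝ := -x * Real.logb 2 x - (1 - x) * Real.logb 2 (1 - x)

/-- Elementary tensor `u ⊗ w`. -/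
def tensor (u : EuclideanSpace ℂ (Fin dA)) (w : EuclideanSpace ℂ (Fin dB)) :
    TensorSpace dA dB := WithLp.toLp 2 fun p => u p.1 * w p.2

/-- One-sided orthogonality on the `B` side:
`Tr[Tr_A(|Ψ⟩⟨Ψ|) ⬝ Tr_A(|Φ⟩⟨Φ|)] = 0`. -/
def OneSidedOrthB (Ψ Φ : TensorSpace dA dB) : Prop :=
  Matrix.trace (trA (ketbra Ψ) * trA (ketbra Φ)) = 0


section Helpers

open scoped ComplexOrder

open Matrix Polynomial in
/-- Entropy functional read off from the roots of a polynomial. -/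
def polyEnt (p : ℂ[X]) : ℝ := (p.roots.map (fun z => Real.negMulLog z.re / Real.log 2)).sum

open Polynomial in
lemma polyEnt_mul {p q : ℂ[X]} (hp : p ≠ 0) (hq : q ≠ 0) :
    polyEnt (p * q) = polyEnt p + polyEnt q := by
  unfold polyEnt
  rw [Polynomial.roots_mul (mul_ne_zero hp hq)]
  simp

open Polynomial in
lemma polyEnt_X_pow (n : ℕ) : polyEnt ((X : ℂ[X]) ^ n) = 0 := by
  unfold polyEnt
  rw [Polynomial.roots_pow]
  simp [Multiset.map_nsmul, Multiset.sum_nsmul]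

/-- Entropy functional of a matrix through its characteristic polynomial. -/
def matEnt {n : Type*} [Fintype n] [DecidableEq n] (M : Matrix n n ℂ) : ℝ := polyEnt M.charpoly

lemma charpoly_ne {n : Type*} [Fintype n] [DecidableEq n] (M : Matrix n n ℂ) :
    M.charpoly ≠ 0 := M.charpoly_monic.ne_zero

open Matrix in
lemma matEnt_mul_comm {m n : Type*} [Fintype m] [DecidableEq m] [Fintype n] [DecidableEq n]
    (A : Matrix m n ℂ) (B : Matrix n m ℂ) : matEnt (A * B) = matEnt (B * A) := by
  have h := congrArg polyEnt (Matrix.charpoly_mul_comm' A B)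
  rw [polyEnt_mul (pow_ne_zero _ Polynomial.X_ne_zero) (charpoly_ne _),
    polyEnt_mul (pow_ne_zero _ Polynomial.X_ne_zero) (charpoly_ne _),
    polyEnt_X_pow, polyEnt_X_pow, zero_add, zero_add] at h
  exact h

open Matrix in
lemma matEnt_eq_sum {n : Type*} [Fintype n] [DecidableEq n] {M : Matrix n n ℂ}
    (h : M.IsHermitian) : matEnt M = ∑ i, Real.negMulLog (h.eigenvalues i) / Real.log 2 := by
  unfold matEnt polyEnt
  rw [h.roots_charpoly_eq_eigenvalues]
  simp

open Matrix in
lemma vnEntropy_eq {n : Type*} [Fintype n] [DecidableEq n] {M : Matrix n n ℂ}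
    (h : M.IsHermitian) : vnEntropy M = matEnt M := by
  rw [matEnt_eq_sum h, vnEntropy, dif_pos h, ← Finset.sum_neg_distrib]
  refine Finset.sum_congr rfl fun i _ => ?_
  simp only [Real.negMulLog, Real.logb]
  ring

open Matrix in
lemma matEnt_transpose {n : Type*} [Fintype n] [DecidableEq n] (M : Matrix n n ℂ) :
    matEnt Mᵀ = matEnt M := by
  unfold matEnt
  rw [Matrix.charpoly_transpose]

open Matrix in
lemma matEnt_diagonal {n : Type*} [Fintype n] [DecidableEq n] (d : n → ℝ) :
    matEnt (diagonal (fun i => (d i : ℂ))) = ∑ i, Real.negMulLog (d i) / Real.log 2 := by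
  unfold matEnt polyEnt
  rw [Matrix.charpoly_diagonal, Polynomial.roots_prod]
  · simp
  · simp [Finset.prod_ne_zero_iff, Polynomial.X_sub_C_ne_zero]

open Matrix in
lemma spectral {n : Type*} [Fintype n] [DecidableEq n] {M : Matrix n n ℂ}
    (h : M.IsHermitian) : ∃ U : Matrix n n ℂ, Uᴴ * U = 1 ∧ U * Uᴴ = 1 ∧
      M = U * diagonal (fun i => (h.eigenvalues i : ℂ)) * Uᴴ := by
  refine ⟨h.eigenvectorUnitary, ?_, ?_, ?_⟩
  · exact Unitary.coe_star_mul_self h.eigenvectorUnitary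
  · exact Unitary.coe_mul_star_self h.eigenvectorUnitary
  · have := h.spectral_theorem
    rw [Unitary.conjStarAlgAut_apply] at this
    exact this

open Matrix in
lemma matEnt_smul {n : Type*} [Fintype n] [DecidableEq n] {M : Matrix n n ℂ}
    (h : M.IsHermitian) (htr : M.trace = 1) (c : ℝ) :
    matEnt (c • M) = c * matEnt M + Real.negMulLog c / Real.log 2 := by
  obtain ⟨U, hU, -, hM⟩ := spectral h
  have h1 : c • M = U * (diagonal (fun i => ((c * h.eigenvalues i : ℝ) : ℂ)) * Uᴴ) := by
    have hd : diagonal (fun i => ((c * h.eigenvalues i : ℝ) : ℂ))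
        = c • diagonal (fun i => (h.eigenvalues i : ℂ)) := by
      ext i j
      by_cases hij : i = j <;> simp [hij, diagonal]
    rw [hd, Matrix.smul_mul, Matrix.mul_smul, ← Matrix.mul_assoc, ← hM]
  have hs : ∑ i, h.eigenvalues i = 1 := by
    have := h.trace_eq_sum_eigenvalues
    rw [htr] at this
    apply Complex.ofReal_injective
    rw [Complex.ofReal_one, Complex.ofReal_sum]
    exact this.symm
  rw [h1, matEnt_mul_comm, Matrix.mul_assoc, hU, Matrix.mul_one, matEnt_diagonal, matEnt_eq_sum h]
  simp only [Real.negMulLog_mul, add_div, Finset.sum_add_distrib]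
  rw [add_comm, Finset.mul_sum]
  congr 1
  · exact Finset.sum_congr rfl fun i _ => by ring
  · rw [← Finset.sum_div, ← Finset.sum_mul, hs, one_mul]

open Matrix in
/-- The entropy is bounded by the entropy of the diagonal. -/
lemma matEnt_le_diag {n : Type*} [Fintype n] [DecidableEq n] {M : Matrix n n ℂ}
    (h : M.PosSemidef) : matEnt M ≤ ∑ i, Real.negMulLog (M i i).re / Real.log 2 := by
  obtain ⟨U, hU, hU', hM⟩ := spectral h.1
  set e := h.1.eigenvalues with he
  have hd : ∀ i, (M i i).re = ∑ k, ‖U i k‖ ^ 2 • e k := by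
    intro i
    have : M i i = ((∑ k, ‖U i k‖ ^ 2 • e k : ℝ) : ℂ) := by
      conv_lhs => rw [hM]
      rw [Matrix.mul_apply]
      push_cast
      refine Finset.sum_congr rfl fun k _ => ?_
      rw [Matrix.mul_diagonal, Matrix.conjTranspose_apply]
      have := Complex.mul_conj' (U i k)
      rw [starRingEnd_apply] at this
      simp only [smul_eq_mul]
      push_cast
      rw [← this]
      ring
    rw [this, Complex.ofReal_re]
  have hrow : ∀ i, ∑ k, ‖U i k‖ ^ 2 = 1 := by
    intro i
    have := congrFun (congrFun hU' i) i
    rw [Matrix.mul_apply, Matrix.one_apply_eq] at this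
    have h2 : ((∑ k, ‖U i k‖ ^ 2 : ℝ) : ℂ) = 1 := by
      rw [← this]
      push_cast
      refine Finset.sum_congr rfl fun k _ => ?_
      rw [← Complex.mul_conj' (U i k)]
      rfl
    exact_mod_cast h2
  have hcol : ∀ k, ∑ i, ‖U i k‖ ^ 2 = 1 := by
    intro k
    have := congrFun (congrFun hU k) k
    rw [Matrix.mul_apply, Matrix.one_apply_eq] at this
    have h2 : ((∑ i, ‖U i k‖ ^ 2 : ℝ) : ℂ) = 1 := by
      rw [← this]
      push_cast
      refine Finset.sum_congr rfl fun i _ => ?_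
      rw [← Complex.conj_mul' (U i k)]
      rfl
    exact_mod_cast h2
  rw [matEnt_eq_sum h.1, ← Finset.sum_div, ← Finset.sum_div]
  refine div_le_div_of_nonneg_right ?_ (Real.log_nonneg (by norm_num))
  calc ∑ k, Real.negMulLog (e k) = ∑ k, (∑ i, ‖U i k‖ ^ 2) * Real.negMulLog (e k) := by
        simp [hcol]
    _ = ∑ i, ∑ k, ‖U i k‖ ^ 2 • Real.negMulLog (e k) := by
        rw [Finset.sum_comm]
        simp [Finset.sum_mul]
    _ ≤ ∑ i, Real.negMulLog (M i i).re := by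
        refine Finset.sum_le_sum fun i _ => ?_
        rw [hd i]
        exact Real.concaveOn_negMulLog.le_map_sum (fun k _ => by positivity) (hrow i)
          (fun k _ => h.eigenvalues_nonneg k)

open Matrix in
lemma factor {n : Type*} [Fintype n] [DecidableEq n] {M : Matrix n n ℂ}
    (h : M.PosSemidef) : ∃ V : Matrix n n ℂ, V * Vᴴ = M ∧
      Vᴴ * V = diagonal (fun i => (h.1.eigenvalues i : ℂ)) := by
  obtain ⟨U, hU, hU', hM⟩ := spectral h.1
  have hdd : diagonal (fun i => ((Real.sqrt (h.1.eigenvalues i) : ℝ) : ℂ)) *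
      diagonal (fun i => ((Real.sqrt (h.1.eigenvalues i) : ℝ) : ℂ)) =
      diagonal (fun i => (h.1.eigenvalues i : ℂ)) := by
    rw [diagonal_mul_diagonal]
    congr 1
    ext i
    rw [← Complex.ofReal_mul, Real.mul_self_sqrt (h.eigenvalues_nonneg i)]
  have hdh : (diagonal (fun i => ((Real.sqrt (h.1.eigenvalues i) : ℝ) : ℂ)))ᴴ =
      diagonal (fun i => ((Real.sqrt (h.1.eigenvalues i) : ℝ) : ℂ)) := by
    rw [diagonal_conjTranspose]
    congr 1
    ext i
    simp
  refine ⟨U * diagonal (fun i => ((Real.sqrt (h.1.eigenvalues i) : ℝ) : ℂ)), ?_, ?_⟩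
  · rw [conjTranspose_mul, hdh, Matrix.mul_assoc, ← Matrix.mul_assoc (diagonal _), hdd,
      ← Matrix.mul_assoc]
    exact hM.symm
  · rw [conjTranspose_mul, hdh, Matrix.mul_assoc, ← Matrix.mul_assoc Uᴴ, hU, Matrix.one_mul, hdd]

open Matrix in
lemma matEnt_gram {n m l : Type*} [Fintype n] [DecidableEq n] [Fintype m] [DecidableEq m]
    [Fintype l] [DecidableEq l] (V : Matrix n m ℂ) (W : Matrix n l ℂ) :
    matEnt (V * Vᴴ + W * Wᴴ) =
      matEnt (fromBlocks (Vᴴ * V) (Vᴴ * W) (Wᴴ * V) (Wᴴ * W)) := by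
  have h1 : V * Vᴴ + W * Wᴴ = fromCols V W * (fromCols V W)ᴴ := by
    rw [conjTranspose_fromCols_eq_fromRows_conjTranspose, fromCols_mul_fromRows]
  rw [h1, matEnt_mul_comm, conjTranspose_fromCols_eq_fromRows_conjTranspose, fromRows_mul_fromCols]

open Matrix in
lemma matEnt_add_le {n : Type*} [Fintype n] [DecidableEq n] {P Q : Matrix n n ℂ}
    (hP : P.PosSemidef) (hQ : Q.PosSemidef) : matEnt (P + Q) ≤ matEnt P + matEnt Q := by
  obtain ⟨V, hV, hV'⟩ := factor hP
  obtain ⟨W, hW, hW'⟩ := factor hQ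
  rw [matEnt_eq_sum hP.1, matEnt_eq_sum hQ.1]
  have hPQ : P + Q = V * Vᴴ + W * Wᴴ := by rw [hV, hW]
  rw [hPQ, matEnt_gram]
  have hps : (fromBlocks (Vᴴ * V) (Vᴴ * W) (Wᴴ * V) (Wᴴ * W)).PosSemidef := by
    rw [← fromRows_mul_fromCols, ← conjTranspose_fromCols_eq_fromRows_conjTranspose]
    exact posSemidef_conjTranspose_mul_self _
  refine (matEnt_le_diag hps).trans (le_of_eq ?_)
  rw [Fintype.sum_sum_type]
  simp [hV', hW']

open Matrix in
lemma matEnt_add_orth {n m l : Type*} [Fintype n] [DecidableEq n] [Fintype m] [DecidableEq m]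
    [Fintype l] [DecidableEq l] (V : Matrix n m ℂ) (W : Matrix n l ℂ) (h : Vᴴ * W = 0) :
    matEnt (V * Vᴴ + W * Wᴴ) = matEnt (Vᴴ * V) + matEnt (Wᴴ * W) := by
  rw [matEnt_gram, h]
  unfold matEnt
  rw [charpoly_fromBlocks_zero₁₂, polyEnt_mul (charpoly_ne _) (charpoly_ne _)]

/-- Coefficient matrix of a bipartite vector. -/
def coefM (ψ : TensorSpace dA dB) : Matrix (Fin dB) (Fin dA) ℂ := fun b a => ψ (a, b)

open Matrix in
lemma trA_eq (ψ : TensorSpace dA dB) : trA (ketbra ψ) = coefM ψ * (coefM ψ)ᴴ := by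
  ext b b'
  simp [trA, ketbra, coefM, Matrix.mul_apply]

open Matrix in
lemma trB_eq (ψ : TensorSpace dA dB) : trB (ketbra ψ) = ((coefM ψ)ᴴ * coefM ψ)ᵀ := by
  ext a a'
  simp [trB, ketbra, coefM, Matrix.mul_apply, mul_comm]

open Matrix in
lemma trB_posSemidef (ψ : TensorSpace dA dB) : (trB (ketbra ψ)).PosSemidef := by
  rw [trB_eq]
  exact (posSemidef_conjTranspose_mul_self _).transpose

open Matrix in
lemma trA_posSemidef (ψ : TensorSpace dA dB) : (trA (ketbra ψ)).PosSemidef := by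
  rw [trA_eq]
  exact posSemidef_self_mul_conjTranspose _

open Matrix in
lemma trB_trace (ψ : TensorSpace dA dB) (h : ‖ψ‖ = 1) : (trB (ketbra ψ)).trace = 1 := by
  have h1 : ∑ p : Fin dA × Fin dB, ‖ψ p‖ ^ 2 = 1 := by
    rw [← EuclideanSpace.norm_sq_eq, h, one_pow]
  have h2 : ((∑ p : Fin dA × Fin dB, ‖ψ p‖ ^ 2 : ℝ) : ℂ) = 1 := by rw [h1, Complex.ofReal_one]
  rw [← h2, Fintype.sum_prod_type]
  push_cast
  simp only [Matrix.trace, Matrix.diag, trB, ketbra, Complex.mul_conj']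

open Matrix in
lemma orth_zero {Ψ Φ : TensorSpace dA dB} (h : OneSidedOrthB Ψ Φ) :
    (coefM Ψ)ᴴ * coefM Φ = 0 := by
  rw [OneSidedOrthB, trA_eq, trA_eq] at h
  rw [← trace_mul_conjTranspose_self_eq_zero_iff, conjTranspose_mul, conjTranspose_conjTranspose,
    ← h, Matrix.trace_mul_comm, ← Matrix.trace_mul_comm]
  rw [Matrix.mul_assoc (coefM Ψ), Matrix.trace_mul_comm (coefM Ψ)]
  simp only [Matrix.mul_assoc]

open Matrix in
lemma smul_gram {m n : Type*} [Fintype m] [Fintype n] (K : Matrix m n ℂ) {p : ℝ} (hp : 0 ≤ p) :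
    p • (K * Kᴴ) = (Real.sqrt p • K) * (Real.sqrt p • K)ᴴ := by
  rw [conjTranspose_smul, Matrix.smul_mul, Matrix.mul_smul, smul_smul]
  simp [Real.mul_self_sqrt hp]

open Matrix in
lemma smul_gram' {m n : Type*} [Fintype m] [Fintype n] (K : Matrix m n ℂ) {p : ℝ} (hp : 0 ≤ p) :
    p • (Kᴴ * K) = (Real.sqrt p • K)ᴴ * (Real.sqrt p • K) := by
  rw [conjTranspose_smul, Matrix.smul_mul, Matrix.mul_smul, smul_smul]
  simp [Real.mul_self_sqrt hp]

open Matrix in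
lemma matEnt_rhoB {Ψ Φ : TensorSpace dA dB} (h : OneSidedOrthB Ψ Φ) {p q : ℝ}
    (hp : 0 ≤ p) (hq : 0 ≤ q) :
    matEnt (p • trA (ketbra Ψ) + q • trA (ketbra Φ)) =
      matEnt (p • trB (ketbra Ψ)) + matEnt (q • trB (ketbra Φ)) := by
  rw [trA_eq, trA_eq, trB_eq, trB_eq, ← transpose_smul, ← transpose_smul, matEnt_transpose,
    matEnt_transpose, smul_gram _ hp, smul_gram _ hq, smul_gram' _ hp, smul_gram' _ hq]
  apply matEnt_add_orth
  rw [conjTranspose_smul, Matrix.smul_mul, Matrix.mul_smul, orth_zero h]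
  simp

theorem main_aux {dA dB : ℕ}
    (Ψ Φ : TensorSpace dA dB) (hΨ : ‖Ψ‖ = 1) (hΦ : ‖Φ‖ = 1)
    (horth : OneSidedOrthB Ψ Φ) (α β : ℂ) (hαβ : ‖α‖ ^ 2 + ‖β‖ ^ 2 = 1) :
    vnEntropy ((‖α‖ ^ 2 : ℝ) • trA (ketbra Ψ) + (‖β‖ ^ 2 : ℝ) • trA (ketbra Φ)) =
      ‖α‖ ^ 2 * ent Ψ + ‖β‖ ^ 2 * ent Φ + h2 (‖α‖ ^ 2) ∧
    vnEntropy ((‖α‖ ^ 2 : ℝ) • trA (ketbra Ψ) + (‖β‖ ^ 2 : ℝ) • trA (ketbra Φ)) ≥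
      vnEntropy ((‖α‖ ^ 2 : ℝ) • trB (ketbra Ψ) + (‖β‖ ^ 2 : ℝ) • trB (ketbra Φ)) := by
  have hp : (0 : ℝ) ≤ ‖α‖ ^ 2 := by positivity
  have hq : (0 : ℝ) ≤ ‖β‖ ^ 2 := by positivity
  have hA := ((trA_posSemidef Ψ).smul hp).add ((trA_posSemidef Φ).smul hq)
  have hBΨ := (trB_posSemidef Ψ).smul hp
  have hBΦ := (trB_posSemidef Φ).smul hq
  rw [vnEntropy_eq hA.1, vnEntropy_eq (hBΨ.add hBΦ).1, matEnt_rhoB horth hp hq]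
  refine ⟨?_, matEnt_add_le hBΨ hBΦ⟩
  rw [matEnt_smul (trB_posSemidef Ψ).1 (trB_trace Ψ hΨ),
    matEnt_smul (trB_posSemidef Φ).1 (trB_trace Φ hΦ), ent, ent,
    vnEntropy_eq (trB_posSemidef Ψ).1, vnEntropy_eq (trB_posSemidef Φ).1, h2,
    ← eq_sub_iff_add_eq'.mpr hαβ]
  simp only [Real.negMulLog, Real.logb]
  ring

end Helpers

/-- for one-sided orthogonal states,
`S(ρ^B) = |α|²E(Ψ) + |β|²E(Φ) + h₂(|α|²)` and `S(ρ^B) ≥ S(ρ^A)`. -/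
theorem entropy_rhoB_one_sided {dA dB : ℕ}
    (Ψ Φ : TensorSpace dA dB) (hΨ : ‖Ψ‖ = 1) (hΦ : ‖Φ‖ = 1)
    (horth : OneSidedOrthB Ψ Φ) (α β : ℂ) (hαβ : ‖α‖ ^ 2 + ‖β‖ ^ 2 = 1) :
    vnEntropy ((‖α‖ ^ 2 : ℝ) • trA (ketbra Ψ) + (‖β‖ ^ 2 : ℝ) • trA (ketbra Φ)) =
      ‖α‖ ^ 2 * ent Ψ + ‖β‖ ^ 2 * ent Φ + h2 (‖α‖ ^ 2) ∧
    vnEntropy ((‖α‖ ^ 2 : ℝ) • trA (ketbra Ψ) + (‖β‖ ^ 2 : ℝ) • trA (ketbra Φ)) ≥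
      vnEntropy ((‖α‖ ^ 2 : ℝ) • trB (ketbra Ψ) + (‖β‖ ^ 2 : ℝ) • trB (ketbra Φ)) := by
  exact main_aux Ψ Φ hΨ hΦ horth α β hαβ

end EoS
end
end

section
/- Let Ψ and Φ be unit vectors in H = ℂ^{d_A} ⊗ ℂ^{d_B} and let α, β ∈ ℂ be such that Γ = αΨ + βΦ is a unit vector (‖Γ‖ = 1). Then for every t with 0 < t < 1, E(Γ) ≥ max{L₁(t), L₂(t)}, where L₁(t) = [(1−t)|β|² / (1 − t(1−|α|²))]·E(Φ) − ((1−t)/t)·E(Ψ) − h₂(t)/t and L₂(t) = [(1−t)|α|² / (1 − t(1−|β|²))]·E(Ψ) − ((1−t)/t)·E(Φ) − h₂(t)/t. -/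
open scoped BigOperators

noncomputable section

namespace EoS

variable {dA dB : ℕ}

section aux

variable {ι E : Type*} [Fintype ι] [NormedAddCommGroup E] [InnerProductSpace ℂ E]

theorem aux_parseval (e : OrthonormalBasis ι ℂ E) (x : E) :
    ∑ i, ‖inner ℂ (e i) x‖ ^ 2 = ‖x‖ ^ 2 := e.sum_sq_norm_inner_right x

theorem aux_diag (e : OrthonormalBasis ι ℂ E) (l : ι → ℝ) (i : ι) :
    ∑ j, l j * ‖inner ℂ (e j) (e i)‖ ^ 2 = l i := by
  classical
  rw [Finset.sum_eq_single i]
  · simp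
  · intro j _ hj
    rw [e.inner_eq_zero hj]; simp
  · simp

theorem aux_zero (e f : OrthonormalBasis ι ℂ E) (l a : ι → ℝ)
    (ha : ∀ k, 0 ≤ a k) (t : ℝ) (ht : 0 < t)
    (hle : ∀ x, t * ∑ k, a k * ‖inner ℂ (f k) x‖ ^ 2 ≤ ∑ i, l i * ‖inner ℂ (e i) x‖ ^ 2)
    (i k : ι) (h : l i ≤ 0) : a k * ‖inner ℂ (f k) (e i)‖ ^ 2 = 0 := by
  have h1 := hle (e i)
  rw [aux_diag] at h1
  have h2 : a k * ‖inner ℂ (f k) (e i)‖ ^ 2 ≤ ∑ k, a k * ‖inner ℂ (f k) (e i)‖ ^ 2 :=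
    Finset.single_le_sum (f := fun k => a k * ‖inner ℂ (f k) (e i)‖ ^ 2)
      (fun k _ => mul_nonneg (ha k) (sq_nonneg _)) (Finset.mem_univ k)
  have h3 : 0 ≤ a k * ‖inner ℂ (f k) (e i)‖ ^ 2 := mul_nonneg (ha k) (sq_nonneg _)
  nlinarith

theorem aux_inv (e f : OrthonormalBasis ι ℂ E) (l a : ι → ℝ)
    (ha : ∀ k, 0 ≤ a k) (hl : ∀ k, 0 ≤ l k) (t : ℝ) (ht : 0 < t)
    (hle : ∀ x, t * ∑ k, a k * ‖inner ℂ (f k) x‖ ^ 2 ≤ ∑ i, l i * ‖inner ℂ (e i) x‖ ^ 2)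
    (k : ι) : t * a k * ∑ i, (l i)⁻¹ * ‖inner ℂ (f k) (e i)‖ ^ 2 ≤ 1 := by
  classical
  set s := ∑ i, (l i)⁻¹ * ‖inner ℂ (f k) (e i)‖ ^ 2 with hs
  have hs0 : 0 ≤ s := Finset.sum_nonneg fun i _ => mul_nonneg (inv_nonneg.2 (hl i)) (sq_nonneg _)
  let x : E := ∑ i, (((l i)⁻¹ : ℝ) * inner ℂ (e i) (f k) : ℂ) • e i
  have hx1 : ∀ i, inner ℂ (e i) x = (((l i)⁻¹ : ℝ) * inner ℂ (e i) (f k) : ℂ) := by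
    intro i
    exact e.orthonormal.inner_right_fintype _ i
  have hx2 : inner ℂ (f k) x = (s : ℂ) := by
    simp only [x, inner_sum, inner_smul_right, hs]
    push_cast
    refine Finset.sum_congr rfl fun i _ => ?_
    rw [← inner_conj_symm (e i) (f k), mul_assoc, ← Complex.normSq_eq_conj_mul_self,
      Complex.normSq_eq_norm_sq]
    push_cast
    rfl
  have h1 := hle x
  have h2 : ∑ i, l i * ‖inner ℂ (e i) x‖ ^ 2 = s := by
    rw [hs]
    refine Finset.sum_congr rfl fun i _ => ?_
    rw [hx1, norm_mul, mul_pow, norm_inner_symm (e i) (f k), Complex.norm_real, Real.norm_eq_abs,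
      sq_abs]
    by_cases h0 : l i = 0
    · simp [h0]
    · field_simp
  have h3 : a k * s ^ 2 ≤ ∑ k, a k * ‖inner ℂ (f k) x‖ ^ 2 := by
    have := Finset.single_le_sum (f := fun k => a k * ‖inner ℂ (f k) x‖ ^ 2)
      (fun k _ => mul_nonneg (ha k) (sq_nonneg _)) (Finset.mem_univ k)
    simpa only [hx2, Complex.norm_real, Real.norm_eq_abs, sq_abs] using this
  rw [h2] at h1
  have h4 : t * (a k * s ^ 2) ≤ s := (mul_le_mul_of_nonneg_left h3 ht.le).trans h1
  rcases hs0.eq_or_lt with h | h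
  · rw [← h]; simp
  · nlinarith

theorem aux_upper (e f : OrthonormalBasis ι ℂ E) (l a : ι → ℝ)
    (ha : ∀ k, 0 ≤ a k) (hl : ∀ k, 0 ≤ l k) (hsum : ∑ k, a k = 1) (t : ℝ) (ht : 0 < t)
    (hle : ∀ x, t * ∑ k, a k * ‖inner ℂ (f k) x‖ ^ 2 ≤ ∑ i, l i * ‖inner ℂ (e i) x‖ ^ 2) :
    Real.log t + ∑ k, a k * Real.log (a k) ≤
      ∑ i, (∑ k, a k * ‖inner ℂ (f k) (e i)‖ ^ 2) * Real.log (l i) := by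
  have key : ∀ k, a k * (Real.log t + Real.log (a k)) ≤
      ∑ i, a k * ‖inner ℂ (f k) (e i)‖ ^ 2 * Real.log (l i) := by
    intro k
    have hD : ∑ i, ‖inner ℂ (f k) (e i)‖ ^ 2 = 1 := by
      rw [e.sum_sq_norm_inner_left]; simp
    have h1 : ∀ i, a k * ‖inner ℂ (f k) (e i)‖ ^ 2 * (Real.log t + Real.log (a k))
        + (a k * ‖inner ℂ (f k) (e i)‖ ^ 2
            - a k * (t * a k * ((l i)⁻¹ * ‖inner ℂ (f k) (e i)‖ ^ 2)))
        ≤ a k * ‖inner ℂ (f k) (e i)‖ ^ 2 * Real.log (l i) := by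
      intro i
      by_cases h0 : a k * ‖inner ℂ (f k) (e i)‖ ^ 2 = 0
      · have : a k * (t * a k * ((l i)⁻¹ * ‖inner ℂ (f k) (e i)‖ ^ 2))
            = (a k * ‖inner ℂ (f k) (e i)‖ ^ 2) * (t * a k * (l i)⁻¹) := by ring
        rw [this, h0]; simp
      · have hli : 0 < l i := by
          by_contra h
          exact h0 (aux_zero e f l a ha t ht hle i k (not_lt.1 h))
        have hak : 0 < a k := (ha k).lt_of_ne (fun h => h0 (by rw [← h]; simp))
        have h2 := Real.one_sub_inv_le_log_of_pos (x := l i / (t * a k)) (by positivity)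
        rw [Real.log_div hli.ne' (by positivity), Real.log_mul ht.ne' hak.ne', inv_div] at h2
        have h3 : 0 ≤ a k * ‖inner ℂ (f k) (e i)‖ ^ 2 := mul_nonneg (ha k) (sq_nonneg _)
        have h4 := mul_le_mul_of_nonneg_left h2 h3
        rw [div_eq_mul_inv] at h4
        linarith
    have h2 := Finset.sum_le_sum fun i (_ : i ∈ Finset.univ) => h1 i
    rw [Finset.sum_add_distrib, Finset.sum_sub_distrib, ← Finset.sum_mul, ← Finset.mul_sum,
      ← Finset.mul_sum, ← Finset.mul_sum, hD] at h2
    have h3 := mul_le_mul_of_nonneg_left (aux_inv e f l a ha hl t ht hle k) (ha k)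
    linarith
  calc Real.log t + ∑ k, a k * Real.log (a k)
      = ∑ k, a k * (Real.log t + Real.log (a k)) := by
        simp only [mul_add, Finset.sum_add_distrib, ← Finset.sum_mul, hsum, one_mul]
    _ ≤ _ := Finset.sum_le_sum fun k _ => key k
    _ = _ := by
        rw [Finset.sum_comm]
        simp only [Finset.sum_mul]

theorem aux_lower (e f : OrthonormalBasis ι ℂ E) (l a : ι → ℝ)
    (ha : ∀ k, 0 ≤ a k) (hl : ∀ k, 0 ≤ l k) (hsum : ∑ k, a k = 1) (hsuml : ∑ k, l k = 1)
    (t : ℝ) (ht : 0 < t)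
    (hle : ∀ x, t * ∑ k, a k * ‖inner ℂ (f k) x‖ ^ 2 ≤ ∑ i, l i * ‖inner ℂ (e i) x‖ ^ 2) :
    ∑ i, (∑ k, a k * ‖inner ℂ (f k) (e i)‖ ^ 2) * Real.log (l i) ≤
      ∑ k, a k * Real.log (a k) := by
  have hD : ∀ k, ∑ i, ‖inner ℂ (f k) (e i)‖ ^ 2 = 1 := by
    intro k
    rw [e.sum_sq_norm_inner_left]; simp
  have hD' : ∀ i, ∑ k, ‖inner ℂ (f k) (e i)‖ ^ 2 = 1 := by
    intro i
    rw [f.sum_sq_norm_inner_right]; simp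
  have h1 : ∀ i k, a k * ‖inner ℂ (f k) (e i)‖ ^ 2 * Real.log (l i) ≤
      a k * Real.log (a k) * ‖inner ℂ (f k) (e i)‖ ^ 2 +
        (l i * ‖inner ℂ (f k) (e i)‖ ^ 2 - a k * ‖inner ℂ (f k) (e i)‖ ^ 2) := by
    intro i k
    by_cases h0 : a k * ‖inner ℂ (f k) (e i)‖ ^ 2 = 0
    · have h2 : a k * Real.log (a k) * ‖inner ℂ (f k) (e i)‖ ^ 2 = 0 := by
        rw [mul_right_comm, h0, zero_mul]
      rw [h2, h0]
      have := mul_nonneg (hl i) (sq_nonneg ‖inner ℂ (f k) (e i)‖)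
      linarith
    · have hli : 0 < l i := by
        by_contra h
        exact h0 (aux_zero e f l a ha t ht hle i k (not_lt.1 h))
      have hak : 0 < a k := (ha k).lt_of_ne (fun h => h0 (by rw [← h]; simp))
      have h2 := Real.log_le_sub_one_of_pos (x := l i / a k) (by positivity)
      rw [Real.log_div hli.ne' hak.ne'] at h2
      have h3 : 0 ≤ a k * ‖inner ℂ (f k) (e i)‖ ^ 2 := mul_nonneg (ha k) (sq_nonneg _)
      have h4 := mul_le_mul_of_nonneg_left h2 h3
      have h5 : a k * ‖inner ℂ (f k) (e i)‖ ^ 2 * (l i / a k - 1) =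
        l i * ‖inner ℂ (f k) (e i)‖ ^ 2 - a k * ‖inner ℂ (f k) (e i)‖ ^ 2 := by
        field_simp
      linarith
  have h2 := Finset.sum_le_sum fun i (_ : i ∈ Finset.univ) =>
    Finset.sum_le_sum fun k (_ : k ∈ Finset.univ) => h1 i k
  simp only [Finset.sum_add_distrib, Finset.sum_sub_distrib] at h2
  have e1 : ∑ i, ∑ k, l i * ‖inner ℂ (f k) (e i)‖ ^ 2 = 1 := by
    simp only [← Finset.mul_sum, hD', mul_one, hsuml]
  have e2 : ∑ i, ∑ k, a k * ‖inner ℂ (f k) (e i)‖ ^ 2 = 1 := by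
    rw [Finset.sum_comm]
    simp only [← Finset.mul_sum, hD, mul_one, hsum]
  have e3 : ∑ i, ∑ k, a k * Real.log (a k) * ‖inner ℂ (f k) (e i)‖ ^ 2
      = ∑ k, a k * Real.log (a k) := by
    rw [Finset.sum_comm]
    simp only [← Finset.mul_sum, hD, mul_one]
  rw [e1, e2, e3] at h2
  simp only [Finset.sum_mul]
  linarith

end aux

/-- Quadratic form of a matrix. -/
def qf {n : Type*} [Fintype n] [DecidableEq n] (M : Matrix n n ℂ) (x : EuclideanSpace ℂ n) : ℝ :=
  (inner ℂ x (Matrix.toEuclideanLin M x)).re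

theorem qf_spectral {n : Type*} [Fintype n] [DecidableEq n] (M : Matrix n n ℂ)
    (h : M.IsHermitian) (x : EuclideanSpace ℂ n) :
    qf M x = ∑ k, h.eigenvalues k * ‖inner ℂ (h.eigenvectorBasis k) x‖ ^ 2 := by
  have hM : ∀ k, Matrix.toEuclideanLin M (h.eigenvectorBasis k)
      = ((h.eigenvalues k : ℝ) : ℂ) • h.eigenvectorBasis k := by
    intro k
    have := h.mulVec_eigenvectorBasis k
    ext i
    have h2 := congrFun this i
    simpa [Matrix.toEuclideanLin_apply] using h2
  have hsym := Matrix.isSymmetric_toEuclideanLin_iff.2 h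
  unfold qf
  rw [← h.eigenvectorBasis.sum_inner_mul_inner, Complex.re_sum]
  refine Finset.sum_congr rfl fun k _ => ?_
  rw [← hsym, hM, inner_smul_left, ← inner_conj_symm x, mul_left_comm,
    ← Complex.normSq_eq_conj_mul_self, Complex.normSq_eq_norm_sq, Complex.conj_ofReal,
    ← Complex.ofReal_mul, Complex.ofReal_re]

/-- column of a bipartite vector -/
def col (ψ : TensorSpace dA dB) (b : Fin dB) : EuclideanSpace ℂ (Fin dA) :=
  WithLp.toLp 2 fun a => ψ (a, b)

theorem qf_trB (ψ : TensorSpace dA dB) (x : EuclideanSpace ℂ (Fin dA)) :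
    qf (trB (ketbra ψ)) x = ∑ b, ‖inner ℂ x (col ψ b)‖ ^ 2 := by
  have h : inner ℂ x (Matrix.toEuclideanLin (trB (ketbra ψ)) x)
      = ∑ b, inner ℂ x (col ψ b) * inner ℂ (col ψ b) x := by
    simp only [PiLp.inner_apply, Matrix.toEuclideanLin_apply, Matrix.mulVec, dotProduct, trB,
      ketbra, col, RCLike.inner_apply, Finset.sum_mul, Finset.mul_sum]
    conv_rhs => rw [Finset.sum_comm]
    first
    | (refine Finset.sum_congr rfl fun i _ => ?_
       conv_rhs => rw [Finset.sum_comm]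
       refine Finset.sum_congr rfl fun j _ => ?_
       refine Finset.sum_congr rfl fun b _ => ?_
       ring; done)
    | (rw [Finset.sum_comm]
       refine Finset.sum_congr rfl fun i _ => ?_
       conv_rhs => rw [Finset.sum_comm]
       refine Finset.sum_congr rfl fun j _ => ?_
       refine Finset.sum_congr rfl fun b _ => ?_
       ring; done)
  unfold qf
  rw [h, Complex.re_sum]
  refine Finset.sum_congr rfl fun b _ => ?_
  rw [← inner_conj_symm (col ψ b) x, Complex.mul_conj, Complex.normSq_eq_norm_sq,
    Complex.ofReal_re]

theorem trB_herm (ψ : TensorSpace dA dB) : (trB (ketbra ψ)).IsHermitian := by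
  ext i j
  simp [trB, ketbra, Matrix.conjTranspose_apply, mul_comm]

theorem sum_qf (ψ : TensorSpace dA dB) (hψ : ‖ψ‖ = 1)
    (e : OrthonormalBasis (Fin dA) ℂ (EuclideanSpace ℂ (Fin dA))) :
    ∑ i, qf (trB (ketbra ψ)) (e i) = 1 := by
  simp only [qf_trB]
  rw [Finset.sum_comm]
  simp only [aux_parseval, EuclideanSpace.norm_sq_eq, col]
  have : ‖ψ‖ ^ 2 = 1 := by rw [hψ]; norm_num
  rw [EuclideanSpace.norm_sq_eq, Fintype.sum_prod_type, Finset.sum_comm] at this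
  exact this

theorem ent_spec (ψ : TensorSpace dA dB) (hψ : ‖ψ‖ = 1) :
    ∃ (f : OrthonormalBasis (Fin dA) ℂ (EuclideanSpace ℂ (Fin dA))) (a : Fin dA → ℝ),
      (∀ k, 0 ≤ a k) ∧ ∑ k, a k = 1 ∧ ent ψ * Real.log 2 = -∑ k, a k * Real.log (a k) ∧
      ∀ x, ∑ k, a k * ‖inner ℂ (f k) x‖ ^ 2 = ∑ b, ‖inner ℂ x (col ψ b)‖ ^ 2 := by
  have h := trB_herm ψ
  have hq : ∀ k, h.eigenvalues k = qf (trB (ketbra ψ)) (h.eigenvectorBasis k) := by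
    intro k
    rw [qf_spectral _ h, aux_diag]
  refine ⟨h.eigenvectorBasis, h.eigenvalues, ?_, ?_, ?_, ?_⟩
  · intro k
    rw [hq, qf_trB]
    exact Finset.sum_nonneg fun _ _ => sq_nonneg _
  · simp only [hq]
    exact sum_qf ψ hψ _
  · have : Real.log 2 ≠ 0 := (Real.log_pos (by norm_num)).ne'
    rw [ent, vnEntropy, dif_pos h, neg_mul, Finset.sum_mul]
    congr 1
    refine Finset.sum_congr rfl fun k _ => ?_
    rw [Real.logb]
    field_simp
  · intro x
    rw [← qf_spectral _ h, qf_trB]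

theorem scalar_ineq (u v α : ℂ) (t : ℝ) (h0 : 0 < t) (h1 : t < 1) :
    t * (1 - t) * ‖u - α * v‖ ^ 2 ≤
      (1 - t * (1 - ‖α‖ ^ 2)) * (t * ‖u‖ ^ 2 + (1 - t) * ‖v‖ ^ 2) := by
  have h := norm_sub_le u (α * v)
  rw [norm_mul] at h
  have h2 : ‖u - α * v‖ ^ 2 ≤ (‖u‖ + ‖α‖ * ‖v‖) ^ 2 := by gcongr
  have h3 : 0 ≤ t * (1 - t) := mul_nonneg h0.le (by linarith)
  have h4 := mul_le_mul_of_nonneg_left h2 h3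
  nlinarith [sq_nonneg (t * ‖α‖ * ‖u‖ - (1 - t) * ‖v‖)]

theorem L1_bound (Ψ Φ : TensorSpace dA dB) (hΨ : ‖Ψ‖ = 1) (hΦ : ‖Φ‖ = 1)
    (α β : ℂ) (hΓ : ‖α • Ψ + β • Φ‖ = 1) (t : ℝ) (h0 : 0 < t) (h1 : t < 1) :
    (1 - t) * ‖β‖ ^ 2 / (1 - t * (1 - ‖α‖ ^ 2)) * ent Φ
              - (1 - t) / t * ent Ψ - h2 t / t ≤ ent (α • Ψ + β • Φ) := by
  set Γ := α • Ψ + β • Φ with hΓd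
  obtain ⟨fG, g, g0, g1, gE, gQ⟩ := ent_spec Γ hΓ
  obtain ⟨fP, p, p0, p1, pE, pQ⟩ := ent_spec Ψ hΨ
  obtain ⟨fF, s, s0, s1, sE, sQ⟩ := ent_spec Φ hΦ
  have h1' : 0 < 1 - t := by linarith
  have hden : 0 < 1 - t * (1 - ‖α‖ ^ 2) := by nlinarith [sq_nonneg ‖α‖]
  -- the mixture
  let R : Matrix (Fin dA) (Fin dA) ℂ :=
    (t : ℂ) • trB (ketbra Γ) + ((1 - t : ℝ) : ℂ) • trB (ketbra Ψ)
  have hR : R.IsHermitian := by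
    have hG := trB_herm Γ
    have hP := trB_herm Ψ
    unfold Matrix.IsHermitian at hG hP ⊢
    simp only [R, Matrix.conjTranspose_add, Matrix.conjTranspose_smul, hG, hP]
    simp
  have hRq : ∀ x, qf R x = t * ∑ b, ‖inner ℂ x (col Γ b)‖ ^ 2
      + (1 - t) * ∑ b, ‖inner ℂ x (col Ψ b)‖ ^ 2 := by
    intro x
    rw [← qf_trB, ← qf_trB]
    simp only [qf, R, map_add, map_smul, LinearMap.add_apply, LinearMap.smul_apply, inner_add_right,
      inner_smul_right, Complex.add_re, Complex.re_ofReal_mul]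
  obtain ⟨e, l, hl⟩ : ∃ (e : OrthonormalBasis (Fin dA) ℂ (EuclideanSpace ℂ (Fin dA)))
      (l : Fin dA → ℝ), ∀ x, ∑ i, l i * ‖inner ℂ (e i) x‖ ^ 2 =
        t * ∑ b, ‖inner ℂ x (col Γ b)‖ ^ 2 + (1 - t) * ∑ b, ‖inner ℂ x (col Ψ b)‖ ^ 2 :=
    ⟨hR.eigenvectorBasis, hR.eigenvalues, fun x => by rw [← qf_spectral R hR, hRq]⟩
  have hli : ∀ i, l i = t * ∑ b, ‖inner ℂ (e i) (col Γ b)‖ ^ 2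
      + (1 - t) * ∑ b, ‖inner ℂ (e i) (col Ψ b)‖ ^ 2 := fun i => by rw [← hl, aux_diag]
  have nn : ∀ (χ : TensorSpace dA dB) x, 0 ≤ ∑ b, ‖inner ℂ x (col χ b)‖ ^ 2 := fun χ x =>
    Finset.sum_nonneg fun _ _ => sq_nonneg _
  have hl0 : ∀ i, 0 ≤ l i := by
    intro i
    rw [hli]
    have := nn Γ (e i)
    have := nn Ψ (e i)
    positivity
  have hl1 : ∑ i, l i = 1 := by
    simp only [hli, Finset.sum_add_distrib, ← Finset.mul_sum]
    have a1 := sum_qf Γ hΓ e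
    have a2 := sum_qf Ψ hΨ e
    simp only [qf_trB] at a1 a2
    rw [a1, a2]; ring
  have hlle : ∀ i, l i ≤ 1 := fun i => by
    rw [← hl1]
    exact Finset.single_le_sum (fun i _ => hl0 i) (Finset.mem_univ i)
  have hlog : ∀ i, Real.log (l i) ≤ 0 := fun i => Real.log_nonpos (hl0 i) (hlle i)
  -- upper bounds
  have U1 := aux_upper e fG l g g0 hl0 g1 t h0 (fun x => by
    rw [gQ, hl]; have := mul_nonneg h1'.le (nn Ψ x); linarith)
  have U2 := aux_upper e fP l p p0 hl0 p1 (1 - t) h1' (fun x => by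
    rw [pQ, hl]; have := mul_nonneg h0.le (nn Γ x); linarith)
  simp only [gQ] at U1
  simp only [pQ] at U2
  have S1 : ∑ i, l i * Real.log (l i) =
      t * ∑ i, (∑ b, ‖inner ℂ (e i) (col Γ b)‖ ^ 2) * Real.log (l i)
      + (1 - t) * ∑ i, (∑ b, ‖inner ℂ (e i) (col Ψ b)‖ ^ 2) * Real.log (l i) := by
    rw [Finset.mul_sum, Finset.mul_sum, ← Finset.sum_add_distrib]
    refine Finset.sum_congr rfl fun i _ => ?_
    nth_rewrite 1 [hli i]
    ring
  -- lower bound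
  set q := t * (1 - t) * ‖β‖ ^ 2 / (1 - t * (1 - ‖α‖ ^ 2)) with hq
  have hq0 : 0 ≤ q := by positivity
  have hcol : ∀ x b, β * inner ℂ x (col Φ b) =
      inner ℂ x (col Γ b) - α * inner ℂ x (col Ψ b) := by
    intro x b
    rw [← inner_smul_right, ← inner_smul_right, ← inner_sub_right]
    congr 1
    ext a
    simp [col, hΓd]
  have hdom : ∀ x, q * ∑ b, ‖inner ℂ x (col Φ b)‖ ^ 2 ≤ ∑ i, l i * ‖inner ℂ (e i) x‖ ^ 2 := by
    intro x
    rw [hl, Finset.mul_sum, Finset.mul_sum, Finset.mul_sum, ← Finset.sum_add_distrib]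
    refine Finset.sum_le_sum fun b _ => ?_
    have := scalar_ineq (inner ℂ x (col Γ b)) (inner ℂ x (col Ψ b)) α t h0 h1
    rw [← hcol, norm_mul, mul_pow] at this
    rw [hq, div_mul_eq_mul_div, div_le_iff₀ hden]
    linarith
  have hlow : ∑ i, l i * Real.log (l i) ≤ q * ∑ k, s k * Real.log (s k) := by
    have b1 : ∑ i, l i * Real.log (l i) ≤
        q * ∑ i, (∑ b, ‖inner ℂ (e i) (col Φ b)‖ ^ 2) * Real.log (l i) := by
      rw [Finset.mul_sum]
      refine Finset.sum_le_sum fun i _ => ?_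
      have := hdom (e i)
      rw [aux_diag] at this
      have := mul_le_mul_of_nonpos_right this (hlog i)
      linarith
    rcases hq0.eq_or_lt with hz | hpos
    · rw [← hz] at b1 ⊢
      linarith
    · have L := aux_lower e fF l s s0 hl0 s1 hl1 q hpos (fun x => by rw [sQ]; exact hdom x)
      simp only [sQ] at L
      exact b1.trans (mul_le_mul_of_nonneg_left L hq0)
  -- combine
  have hl2 : 0 < Real.log 2 := Real.log_pos (by norm_num)
  have hh : h2 t * Real.log 2 = -t * Real.log t - (1 - t) * Real.log (1 - t) := by
    unfold h2 Real.logb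
    field_simp
  have M1 := mul_le_mul_of_nonneg_left U1 h0.le
  have M2 := mul_le_mul_of_nonneg_left U2 h1'.le
  have F : q * ent Φ * Real.log 2 ≤ (t * ent Γ + (1 - t) * ent Ψ + h2 t) * Real.log 2 := by
    have e1 : q * ent Φ * Real.log 2 = q * (ent Φ * Real.log 2) := by ring
    have e2 : (t * ent Γ + (1 - t) * ent Ψ + h2 t) * Real.log 2 =
      t * (ent Γ * Real.log 2) + (1 - t) * (ent Ψ * Real.log 2) + h2 t * Real.log 2 := by ring
    rw [e1, e2, sE, gE, pE, hh]
    linarith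
  have F' := le_of_mul_le_mul_right F hl2
  have e3 : (1 - t) * ‖β‖ ^ 2 / (1 - t * (1 - ‖α‖ ^ 2)) * ent Φ
      - (1 - t) / t * ent Ψ - h2 t / t = (q * ent Φ - (1 - t) * ent Ψ - h2 t) / t := by
    rw [hq]
    field_simp
  rw [e3, div_le_iff₀ h0]
  linarith

/-- Theorem 4 of the paper: the lower bounds `L₁(t)`, `L₂(t)`. -/
theorem lower_bound_family {dA dB : ℕ}
    (Ψ Φ : TensorSpace dA dB) (hΨ : ‖Ψ‖ = 1) (hΦ : ‖Φ‖ = 1)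
    (α β : ℂ) (hΓ : ‖α • Ψ + β • Φ‖ = 1) :
    ∀ t : ℝ, 0 < t → t < 1 →
      ent (α • Ψ + β • Φ) ≥
        max ((1 - t) * ‖β‖ ^ 2 / (1 - t * (1 - ‖α‖ ^ 2)) * ent Φ
              - (1 - t) / t * ent Ψ - h2 t / t)
            ((1 - t) * ‖α‖ ^ 2 / (1 - t * (1 - ‖β‖ ^ 2)) * ent Ψ
              - (1 - t) / t * ent Φ - h2 t / t) := by
  intro t h0 h1
  refine max_le (L1_bound Ψ Φ hΨ hΦ α β hΓ t h0 h1) ?_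
  rw [add_comm] at hΓ ⊢
  exact L1_bound Φ Ψ hΦ hΨ β α hΓ t h0 h1

end EoS
end
end
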